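/- Assume Γ is Q-polynomial with respect to E. Then for all distinct vertices x, y ∈ X with i = ∂(x,y): E x̂ ⋆ E ŷ = [ (θ*_{i-1} − θ*_i) C(x,y) + (θ*_{i+1} − θ*_i) B(x,y) + (θ₂ − θ₀)(E x̂ + E ŷ) ] / ( |X| (θ₁ − θ₂) ). -/

import Mathlib

open Matrix Finset
open scoped Classical

/-- A distance-regular graph `Γ` with vertex set `X`, path-length distance
`G.dist`, diameter `d ≥ 2`, and intersection numbers `p h i j`. -/
structure DRG where
  X : Type
  [fin : Fintype X]
  [deceq : DecidableEq X]
  G : SimpleGraph X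
  conn : G.Connected
  d : ℕ
  d_ge_two : 2 ≤ d
  dist_le : ∀ x y : X, G.dist x y ≤ d
  dist_attained : ∃ x y : X, G.dist x y = d
  p : ℕ → ℕ → ℕ → ℕ
  dist_regular : ∀ (h i j : ℕ) (x y : X), G.dist x y = h →
    (Finset.univ.filter fun z => G.dist x z = i ∧ G.dist y z = j).card = p h i j

attribute [instance] DRG.fin DRG.deceq

namespace DRG

variable (Γ : DRG)

/-- `Γ_i(x) = {z : ∂(x,z) = i}`. -/
noncomputable def sphere (x : Γ.X) (i : ℕ) : Finset Γ.X :=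
  Finset.univ.filter fun z => Γ.G.dist x z = i

/-- The number of vertices `|X|`, as a real number. -/
noncomputable def n : ℝ := (Fintype.card Γ.X : ℝ)

/-- The `i`-th distance matrix `A_i`. -/
noncomputable def Ai (i : ℕ) : Matrix Γ.X Γ.X ℝ :=
  Matrix.of fun x y => if Γ.G.dist x y = i then (1 : ℝ) else 0

/-- The adjacency matrix `A = A_1`. -/
noncomputable def A : Matrix Γ.X Γ.X ℝ := Γ.Ai 1

/-- The all-ones matrix `J`. -/
def Jmat : Matrix Γ.X Γ.X ℝ := Matrix.of fun _ _ => (1 : ℝ)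

/-- `c_i = p^i_{1,i-1}` (so `c_0 = 0`). -/
noncomputable def c (i : ℕ) : ℝ := (Γ.p i 1 (i - 1) : ℝ)

/-- `a_i = p^i_{1,i}`. -/
noncomputable def a (i : ℕ) : ℝ := (Γ.p i 1 i : ℝ)

/-- `b_i = p^i_{1,i+1}` (so `b_d = 0`). -/
noncomputable def b (i : ℕ) : ℝ := (Γ.p i 1 (i + 1) : ℝ)

/-- The standard basis vector `x̂`. -/
noncomputable def hatv (x : Γ.X) : Γ.X → ℝ := Pi.single x 1

/-- `x⁺_y = Σ_{z ∈ Γ(x) ∩ Γ_{i+1}(y)} ẑ` where `i = ∂(x,y)`. -/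
noncomputable def plusv (x y : Γ.X) : Γ.X → ℝ :=
  ∑ z ∈ Γ.sphere x 1 ∩ Γ.sphere y (Γ.G.dist x y + 1), Γ.hatv z

/-- `x⁰_y = Σ_{z ∈ Γ(x) ∩ Γ_i(y)} ẑ` where `i = ∂(x,y)`. -/
noncomputable def zerov (x y : Γ.X) : Γ.X → ℝ :=
  ∑ z ∈ Γ.sphere x 1 ∩ Γ.sphere y (Γ.G.dist x y), Γ.hatv z

/-- `x⁻_y = Σ_{z ∈ Γ(x) ∩ Γ_{i-1}(y)} ẑ` where `i = ∂(x,y)`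
(for `i = 0` this is the zero vector, matching `Γ_{-1}(y) = ∅`). -/
noncomputable def minusv (x y : Γ.X) : Γ.X → ℝ :=
  ∑ z ∈ Γ.sphere x 1 ∩ Γ.sphere y (Γ.G.dist x y - 1), Γ.hatv z

/-- The Norton product `u ⋆ v = E (u ∘ v)`, where `∘` is the entrywise
(Hadamard) product of vectors. -/
noncomputable def norton (E : Matrix Γ.X Γ.X ℝ) (u v : Γ.X → ℝ) : Γ.X → ℝ :=
  E *ᵥ (u * v)

/-- `E 0, …, E d` is the sequence of primitive idempotents of the Bose–Mesner
algebra, with `E 0 = |X|⁻¹ J`, and `θ 0, …, θ d` are the corresponding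
(mutually distinct) eigenvalues, so that `A = Σ_i θ i • E i`. -/
def IsPrimIdemSeq (E : ℕ → Matrix Γ.X Γ.X ℝ) (θ : ℕ → ℝ) : Prop :=
  E 0 = (Γ.n)⁻¹ • Γ.Jmat ∧
  ∑ i ∈ Finset.range (Γ.d + 1), E i = 1 ∧
  (∀ i j : ℕ, i ≤ Γ.d → j ≤ Γ.d → E i * E j = if i = j then E i else 0) ∧
  Γ.A = ∑ i ∈ Finset.range (Γ.d + 1), θ i • E i ∧
  (∀ i j : ℕ, i ≤ Γ.d → j ≤ Γ.d → θ i = θ j → i = j)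

/-- `q h i j` are the Krein parameters:
`E i ∘ E j = |X|⁻¹ Σ_h q h i j • E h`, with `∘` the entrywise product. -/
def IsKrein (E : ℕ → Matrix Γ.X Γ.X ℝ) (q : ℕ → ℕ → ℕ → ℝ) : Prop :=
  ∀ i j : ℕ, i ≤ Γ.d → j ≤ Γ.d →
    Matrix.hadamard (E i) (E j) =
      (Γ.n)⁻¹ • ∑ h ∈ Finset.range (Γ.d + 1), q h i j • E h

/-- The ordering `E 1, …, E d` is `Q`-polynomial: for `0 ≤ h,i,j ≤ d`,
`q h i j = 0` if one of `h,i,j` is greater than the sum of the other two, and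
`q h i j ≠ 0` if one of `h,i,j` equals the sum of the other two. -/
def IsQPolynomial (q : ℕ → ℕ → ℕ → ℝ) : Prop :=
  ∀ h i j : ℕ, h ≤ Γ.d → i ≤ Γ.d → j ≤ Γ.d →
    ((i + j < h ∨ h + j < i ∨ h + i < j) → q h i j = 0) ∧
    ((h = i + j ∨ i = h + j ∨ j = h + i) → q h i j ≠ 0)

/-- `ts 0, …, ts d` are the (mutually distinct) dual eigenvalues associated
with `E`, i.e. `E = |X|⁻¹ Σ_i ts i • A i`.  The values `ts (-1)` and
`ts (d+1)` are arbitrary reals (indeterminates). -/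
def IsDualEigs (E : Matrix Γ.X Γ.X ℝ) (ts : ℤ → ℝ) : Prop :=
  E = (Γ.n)⁻¹ • ∑ i ∈ Finset.range (Γ.d + 1), ts i • Γ.Ai i

/-- The dual eigenvalues `ts 0, …, ts d` are mutually distinct. -/
def DualDistinct (ts : ℤ → ℝ) : Prop :=
  ∀ i j : ℕ, i ≤ Γ.d → j ≤ Γ.d → ts i = ts j → i = j

/-- `C(x,y) = E x⁻_y − c_i ((θ*_1 − θ*_{i-1})/(θ*_0 − θ*_i)) E x̂`,
where `i = ∂(x,y)`. -/
noncomputable def Cvec (E : Matrix Γ.X Γ.X ℝ) (ts : ℤ → ℝ) (x y : Γ.X) :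
    Γ.X → ℝ :=
  E *ᵥ Γ.minusv x y -
    (Γ.c (Γ.G.dist x y) *
      ((ts 1 - ts ((Γ.G.dist x y : ℤ) - 1)) / (ts 0 - ts (Γ.G.dist x y)))) •
      (E *ᵥ Γ.hatv x)

/-- `B(x,y) = E x⁺_y − b_i ((θ*_1 − θ*_{i+1})/(θ*_0 − θ*_i)) E x̂`,
where `i = ∂(x,y)`. -/
noncomputable def Bvec (E : Matrix Γ.X Γ.X ℝ) (ts : ℤ → ℝ) (x y : Γ.X) :
    Γ.X → ℝ :=
  E *ᵥ Γ.plusv x y -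
    (Γ.b (Γ.G.dist x y) *
      ((ts 1 - ts ((Γ.G.dist x y : ℤ) + 1)) / (ts 0 - ts (Γ.G.dist x y)))) •
      (E *ᵥ Γ.hatv x)

end DRG

namespace DRG

variable {Γ : DRG} {E : ℕ → Matrix Γ.X Γ.X ℝ} {θ : ℕ → ℝ} {q : ℕ → ℕ → ℕ → ℝ} {ts : ℤ → ℝ}

lemma n_ne_zero (Γ : DRG) : Γ.n ≠ 0 := by
  obtain ⟨x, -⟩ := Γ.dist_attained
  have : Nonempty Γ.X := ⟨x⟩
  simp [n]

lemma A_mulVec_apply (F : Γ.X → ℝ) (x : Γ.X) :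
    (Γ.A *ᵥ F) x = ∑ t ∈ Γ.sphere x 1, F t := by
  simp [Matrix.mulVec, dotProduct, A, Ai, sphere, Finset.sum_filter]

lemma A_transpose (Γ : DRG) : Γ.Aᵀ = Γ.A := by
  ext x y
  simp [A, Ai, Γ.G.adj_comm]

lemma IsPrimIdemSeq.A_mul (hE : Γ.IsPrimIdemSeq E θ) {j : ℕ} (hj : j ≤ Γ.d) :
    Γ.A * E j = θ j • E j := by
  obtain ⟨-, -, hmul, hA, -⟩ := hE
  rw [hA, Finset.sum_mul, Finset.sum_eq_single j]
  · simp [hmul j j hj hj]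
  · intro i hi hij
    rw [Matrix.smul_mul, hmul i j (by simpa [Nat.lt_succ_iff] using hi) hj, if_neg hij, smul_zero]
  · intro h
    exact absurd (Finset.mem_range.2 (Nat.lt_succ_of_le hj)) h

lemma IsPrimIdemSeq.transpose_eq (hE : Γ.IsPrimIdemSeq E θ) {h : ℕ} (hh : h ≤ Γ.d) :
    (E h)ᵀ = E h := by
  have key : (E h)ᵀ = (E h)ᵀ * E h := by
    conv_lhs => rw [← mul_one (E h)ᵀ, ← hE.2.1, Finset.mul_sum]
    refine Finset.sum_eq_single h (fun j hj hjh => ?_) (fun hn => ?_)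
    · have hj' : j ≤ Γ.d := by simpa [Nat.lt_succ_iff] using hj
      have h1 : (E h)ᵀ * Γ.A = θ h • (E h)ᵀ := by
        rw [← Γ.A_transpose, ← Matrix.transpose_mul, hE.A_mul hh, Matrix.transpose_smul]
      have h2 : θ h • ((E h)ᵀ * E j) = θ j • ((E h)ᵀ * E j) := by
        rw [← Matrix.smul_mul, ← h1, Matrix.mul_assoc, hE.A_mul hj', Matrix.mul_smul]
      have h3 : (θ h - θ j) • ((E h)ᵀ * E j) = 0 := by rw [sub_smul, h2, sub_self]
      refine (smul_eq_zero.1 h3).resolve_left fun h0 => hjh ?_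
      exact (hE.2.2.2.2 h j hh hj' (sub_eq_zero.1 h0)).symm
    · exact absurd (Finset.mem_range.2 (Nat.lt_succ_of_le hh)) hn
  have := congrArg Matrix.transpose key
  rw [Matrix.transpose_mul, Matrix.transpose_transpose, ← key] at this
  exact this.symm

lemma IsPrimIdemSeq.apply_comm (hE : Γ.IsPrimIdemSeq E θ) {h : ℕ} (hh : h ≤ Γ.d) (x y : Γ.X) :
    E h x y = E h y x := by
  conv_lhs => rw [← hE.transpose_eq hh]
  rfl

lemma IsPrimIdemSeq.sum_mul_self (hE : Γ.IsPrimIdemSeq E θ) {h : ℕ} (hh : h ≤ Γ.d) (x y : Γ.X) :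
    ∑ w, E h w x * E h w y = E h x y := by
  have := congrFun (congrFun (hE.2.2.1 h h hh hh) x) y
  rw [if_pos rfl, Matrix.mul_apply] at this
  rw [← this]
  exact Finset.sum_congr rfl fun w _ => by rw [hE.apply_comm hh w x]

/-- If a Krein parameter vanishes, then so does the corresponding component of every entrywise
product of columns of two primitive idempotents. -/
lemma mulVec_mul_eq_zero_of_krein_eq_zero (hE : Γ.IsPrimIdemSeq E θ) (hq : Γ.IsKrein E q)
    {h i j : ℕ} (hh : h ≤ Γ.d) (hi : i ≤ Γ.d) (hj : j ≤ Γ.d) (h0 : q h i j = 0) (y z : Γ.X) :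
    E h *ᵥ (fun w => E i y w * E j z w) = 0 := by
  set T : Γ.X → Γ.X → Γ.X → ℝ := fun y z x => ∑ w, E h x w * (E i y w * E j z w) with hT
  have hsq : ∑ y, ∑ z, ∑ x, T y z x ^ 2 = ∑ w, ∑ v, E h w v * (E i w v * E j w v) := by
    calc ∑ y, ∑ z, ∑ x, T y z x ^ 2
        = ∑ y, ∑ z, ∑ w, ∑ v, E h w v * ((E i y w * E i y v) * (E j z w * E j z v)) := by
          refine Finset.sum_congr rfl fun y _ => Finset.sum_congr rfl fun z _ => ?_
          simp only [hT, sq, Finset.sum_mul_sum]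
          rw [Finset.sum_comm]
          refine Finset.sum_congr rfl fun w _ => ?_
          rw [Finset.sum_comm]
          refine Finset.sum_congr rfl fun v _ => ?_
          rw [← hE.sum_mul_self hh w v, Finset.sum_mul]
          exact Finset.sum_congr rfl fun x _ => by ring
      _ = ∑ w, ∑ v, ∑ y, ∑ z, E h w v * ((E i y w * E i y v) * (E j z w * E j z v)) := by
          refine (Finset.sum_congr rfl fun y _ => Finset.sum_comm.trans
            (Finset.sum_congr rfl fun w _ => Finset.sum_comm)).trans ?_
          exact Finset.sum_comm.trans (Finset.sum_congr rfl fun w _ => Finset.sum_comm)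
      _ = _ := by
          refine Finset.sum_congr rfl fun w _ => Finset.sum_congr rfl fun v _ => ?_
          rw [← hE.sum_mul_self hi w v, ← hE.sum_mul_self hj w v, Finset.sum_mul_sum,
            Finset.mul_sum]
          exact Finset.sum_congr rfl fun y _ => by rw [Finset.mul_sum]
  have hzero : ∑ w, ∑ v, E h w v * (E i w v * E j w v) = 0 := by
    refine Finset.sum_eq_zero fun w _ => ?_
    have hw : ∀ l ∈ Finset.range (Γ.d + 1), q l i j * ∑ v, E h w v * E l v w = 0 := by
      intro l hl
      have hl' : l ≤ Γ.d := by simpa [Nat.lt_succ_iff] using hl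
      by_cases hlh : l = h
      · rw [hlh, h0, zero_mul]
      · have := congrFun (congrFun (hE.2.2.1 h l hh hl') w) w
        rw [if_neg (Ne.symm hlh), Matrix.mul_apply] at this
        rw [this, Matrix.zero_apply, mul_zero]
    calc ∑ v, E h w v * (E i w v * E j w v)
        = ∑ v, E h w v * ((Γ.n)⁻¹ * ∑ l ∈ Finset.range (Γ.d + 1), q l i j * E l v w) := by
          refine Finset.sum_congr rfl fun v _ => ?_
          have := congrFun (congrFun (hq i j hi hj) v) w
          simp only [Matrix.hadamard_apply, Matrix.smul_apply, Matrix.sum_apply,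
            smul_eq_mul] at this
          rw [← this, hE.apply_comm hi w v, hE.apply_comm hj w v]
      _ = (Γ.n)⁻¹ * ∑ l ∈ Finset.range (Γ.d + 1), q l i j * ∑ v, E h w v * E l v w := by
          simp only [Finset.mul_sum]
          rw [Finset.sum_comm]
          exact Finset.sum_congr rfl fun l _ => Finset.sum_congr rfl fun v _ => by ring
      _ = 0 := by rw [Finset.sum_eq_zero hw, mul_zero]
  rw [hzero] at hsq
  have h1 := (Finset.sum_eq_zero_iff_of_nonneg fun y _ => Finset.sum_nonneg fun z _ =>
    Finset.sum_nonneg fun x _ => sq_nonneg _).1 hsq y (Finset.mem_univ y)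
  have h2 := (Finset.sum_eq_zero_iff_of_nonneg fun z _ =>
    Finset.sum_nonneg fun x _ => sq_nonneg _).1 h1 z (Finset.mem_univ z)
  ext x
  exact pow_eq_zero_iff two_ne_zero |>.1
    ((Finset.sum_eq_zero_iff_of_nonneg fun x _ => sq_nonneg _).1 h2 x (Finset.mem_univ x))

lemma IsPrimIdemSeq.A_mulVec_of_eq_zero (hE : Γ.IsPrimIdemSeq E θ) (g : Γ.X → ℝ)
    (hg : ∀ h, 2 < h → h ≤ Γ.d → E h *ᵥ g = 0) :
    Γ.A *ᵥ g = θ 2 • g + (θ 0 - θ 2) • (E 0 *ᵥ g) + (θ 1 - θ 2) • (E 1 *ᵥ g) := by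
  have hd := Γ.d_ge_two
  have hsub : Finset.range 3 ⊆ Finset.range (Γ.d + 1) :=
    Finset.range_subset_range.2 (by omega)
  have hvan : ∀ h ∈ Finset.range (Γ.d + 1), h ∉ Finset.range 3 → E h *ᵥ g = 0 := by
    intro h hh hh3
    simp only [Finset.mem_range] at hh hh3
    exact hg h (by omega) (by omega)
  have h1 : g = ∑ h ∈ Finset.range 3, E h *ᵥ g := by
    rw [Finset.sum_subset hsub hvan, ← Matrix.sum_mulVec, hE.2.1, Matrix.one_mulVec]
  have h2 : Γ.A *ᵥ g = ∑ h ∈ Finset.range 3, θ h • (E h *ᵥ g) := by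
    rw [Finset.sum_subset hsub fun h hh hh3 => by rw [hvan h hh hh3, smul_zero], hE.2.2.2.1,
      Matrix.sum_mulVec]
    simp only [Matrix.smul_mulVec]
  rw [h2, show θ 2 • g = _ from congrArg (θ 2 • ·) h1]
  simp only [Finset.sum_range_succ, Finset.sum_range_zero]
  module

lemma IsDualEigs.apply (hts : Γ.IsDualEigs (E 1) ts) (x y : Γ.X) :
    E 1 x y = (Γ.n)⁻¹ * ts (Γ.G.dist x y) := by
  rw [hts]
  simp [Matrix.sum_apply, Ai, Γ.dist_le]

lemma IsPrimIdemSeq.card_sphere_one (hE : Γ.IsPrimIdemSeq E θ) (x : Γ.X) :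
    ((Γ.sphere x 1).card : ℝ) = θ 0 := by
  have h := congrFun (congrFun (hE.A_mul (Nat.zero_le _)) x) x
  rw [hE.1, Matrix.mul_smul, Matrix.smul_apply, smul_comm, Matrix.smul_apply] at h
  have h' := smul_right_injective ℝ (inv_ne_zero Γ.n_ne_zero) h
  simpa [Matrix.mul_apply, Jmat, A, Ai, sphere] using h'

lemma sum_dualEig_sphere_one (hE : Γ.IsPrimIdemSeq E θ) (hts : Γ.IsDualEigs (E 1) ts)
    (x y : Γ.X) :
    ∑ t ∈ Γ.sphere x 1, ts (Γ.G.dist y t) = θ 1 * ts (Γ.G.dist x y) := by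
  have h := congrFun (congrFun (hE.A_mul (by have := Γ.d_ge_two; omega : 1 ≤ Γ.d)) x) y
  have hx : ∑ t ∈ Γ.sphere x 1, E 1 t y = θ 1 * E 1 x y := by
    rw [← A_mulVec_apply fun t => E 1 t y]
    exact h
  simp only [hts.apply, ← Finset.mul_sum] at hx
  apply mul_left_cancel₀ (inv_ne_zero Γ.n_ne_zero)
  simp only [Γ.G.dist_comm (u := y)]
  linear_combination hx

lemma norton_apply (hE : Γ.IsPrimIdemSeq E θ) (x y z : Γ.X) :
    Γ.norton (E 1) (E 1 *ᵥ Γ.hatv x) (E 1 *ᵥ Γ.hatv y) z =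
      (E 1 *ᵥ fun w => E 1 y w * E 1 z w) x := by
  have hd := Γ.d_ge_two
  simp only [norton, hatv, Matrix.mulVec_single_one, Matrix.mulVec, dotProduct]
  refine Finset.sum_congr rfl fun w _ => ?_
  simp only [Pi.mul_apply, Matrix.col_apply]
  rw [hE.apply_comm (by omega) x w, hE.apply_comm (by omega) y w]
  ring

lemma sum_dualEig_mul_sphere_one (hE : Γ.IsPrimIdemSeq E θ) (hq : Γ.IsKrein E q)
    (hQ : Γ.IsQPolynomial q) (hts : Γ.IsDualEigs (E 1) ts) (x y z : Γ.X) :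
    ∑ t ∈ Γ.sphere x 1, ts (Γ.G.dist y t) * E 1 z t =
      θ 2 * (ts (Γ.G.dist x y) * E 1 z x) + (θ 0 - θ 2) * E 1 y z +
        Γ.n * (θ 1 - θ 2) *
          Γ.norton (E 1) (E 1 *ᵥ Γ.hatv x) (E 1 *ᵥ Γ.hatv y) z := by
  have hd := Γ.d_ge_two
  have hn := Γ.n_ne_zero
  have h := congrFun (hE.A_mulVec_of_eq_zero (fun w => E 1 y w * E 1 z w) fun h h2 hh =>
    mulVec_mul_eq_zero_of_krein_eq_zero hE hq hh (by omega) (by omega)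
      ((hQ h 1 1 hh (by omega) (by omega)).1 (by omega)) y z) x
  have h0 : (E 0 *ᵥ fun w => E 1 y w * E 1 z w) x = (Γ.n)⁻¹ * E 1 y z := by
    rw [← hE.sum_mul_self (by omega) y z, hE.1, Finset.mul_sum]
    simp only [Matrix.mulVec, dotProduct, Matrix.smul_apply, Jmat, Matrix.of_apply, smul_eq_mul,
      mul_one]
    exact Finset.sum_congr rfl fun w _ => by
      rw [hE.apply_comm (by omega) y w, hE.apply_comm (by omega) z w]
  have hl : ∑ t ∈ Γ.sphere x 1, ts (Γ.G.dist y t) * E 1 z t =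
      Γ.n * ∑ t ∈ Γ.sphere x 1, E 1 y t * E 1 z t := by
    rw [Finset.mul_sum]
    refine Finset.sum_congr rfl fun t _ => ?_
    rw [hts.apply y t]
    field_simp
  rw [A_mulVec_apply] at h
  simp only [Pi.add_apply, Pi.smul_apply, smul_eq_mul, h0, ← norton_apply hE] at h
  rw [hl, h, hts.apply y x, Γ.G.dist_comm (u := y)]
  field_simp

lemma norton_apply_right (hE : Γ.IsPrimIdemSeq E θ) (hq : Γ.IsKrein E q)
    (hts : Γ.IsDualEigs (E 1) ts) (x y : Γ.X) :
    Γ.norton (E 1) (E 1 *ᵥ Γ.hatv x) (E 1 *ᵥ Γ.hatv y) y =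
      (Γ.n)⁻¹ * q 1 1 1 * ((Γ.n)⁻¹ * ts (Γ.G.dist x y)) := by
  have hd := Γ.d_ge_two
  have h1 : 1 ≤ Γ.d := by omega
  have hh : E 1 * Matrix.hadamard (E 1) (E 1) = ((Γ.n)⁻¹ * q 1 1 1) • E 1 := by
    rw [hq 1 1 h1 h1, Matrix.mul_smul, Finset.mul_sum, Finset.sum_eq_single 1, Matrix.mul_smul,
      hE.2.2.1 1 1 h1 h1, if_pos rfl, smul_smul]
    · intro l hl hl1
      rw [Matrix.mul_smul, hE.2.2.1 1 l h1 (by simpa [Nat.lt_succ_iff] using hl),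
        if_neg (Ne.symm hl1), smul_zero]
    · intro hn
      exact absurd (Finset.mem_range.2 (Nat.lt_succ_of_le h1)) hn
  have := congrFun (congrFun hh x) y
  rw [Matrix.smul_apply, smul_eq_mul, Matrix.mul_apply, hts.apply x y] at this
  rw [norton_apply hE, ← this]
  refine Finset.sum_congr rfl fun w _ => ?_
  simp only [Matrix.hadamard_apply]
  rw [hE.apply_comm h1 y w]

/-- The neighbours of `x` lie at distance `i - 1`, `i` or `i + 1` from `y`, where `i = ∂(x,y)`. -/
lemma sum_sphere_one_eq {x y : Γ.X} (hxy : x ≠ y) (g : ℤ → ℝ) (f : Γ.X → ℝ) :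
    ∑ t ∈ Γ.sphere x 1, g (Γ.G.dist y t) * f t =
      (g ((Γ.G.dist x y : ℤ) - 1) - g (Γ.G.dist x y)) *
          ∑ t ∈ Γ.sphere x 1 ∩ Γ.sphere y (Γ.G.dist x y - 1), f t +
        (g ((Γ.G.dist x y : ℤ) + 1) - g (Γ.G.dist x y)) *
          ∑ t ∈ Γ.sphere x 1 ∩ Γ.sphere y (Γ.G.dist x y + 1), f t +
        g (Γ.G.dist x y) * ∑ t ∈ Γ.sphere x 1, f t := by
  have hpos : 0 < Γ.G.dist x y := Γ.conn.pos_dist_of_ne hxy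
  have hinter : ∀ j, Γ.sphere x 1 ∩ Γ.sphere y j =
      (Γ.sphere x 1).filter fun t => Γ.G.dist y t = j := by
    intro j
    ext t
    simp [sphere]
  simp only [hinter, Finset.sum_filter, Finset.mul_sum, ← Finset.sum_add_distrib]
  refine Finset.sum_congr rfl fun t ht => ?_
  have ht1 : Γ.G.dist x t = 1 := by simpa [sphere] using ht
  have h1 := Γ.conn.dist_triangle (u := y) (v := x) (w := t)
  have h2 := Γ.conn.dist_triangle (u := y) (v := t) (w := x)
  rw [Γ.G.dist_comm (u := t), ht1, Γ.G.dist_comm (u := y) (v := x)] at h2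
  rw [ht1, Γ.G.dist_comm (u := y) (v := x)] at h1
  generalize Γ.G.dist x y = i at *
  have h3 : Γ.G.dist y t = i - 1 ∨ Γ.G.dist y t = i ∨ Γ.G.dist y t = i + 1 := by omega
  rcases h3 with h | h | h
  · rw [h, if_pos rfl, if_neg (by omega), Nat.cast_sub hpos, Nat.cast_one]
    ring
  · rw [h, if_neg (by omega), if_neg (by omega)]
    ring
  · rw [h, if_neg (by omega), if_pos rfl, Nat.cast_add, Nat.cast_one]
    ring

lemma card_sphere_inter (x y : Γ.X) (j : ℕ) :
    (Γ.sphere x 1 ∩ Γ.sphere y j).card = Γ.p (Γ.G.dist x y) 1 j := by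
  rw [← Γ.dist_regular _ 1 j x y rfl]
  congr 1
  ext t
  simp [sphere]

lemma sum_apply_dist_sphere_one (hE : Γ.IsPrimIdemSeq E θ) {x y : Γ.X} (hxy : x ≠ y)
    (g : ℤ → ℝ) :
    ∑ t ∈ Γ.sphere x 1, g (Γ.G.dist y t) =
      (g ((Γ.G.dist x y : ℤ) - 1) - g (Γ.G.dist x y)) * Γ.c (Γ.G.dist x y) +
        (g ((Γ.G.dist x y : ℤ) + 1) - g (Γ.G.dist x y)) * Γ.b (Γ.G.dist x y) +
        g (Γ.G.dist x y) * θ 0 := by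
  have h := sum_sphere_one_eq hxy g fun _ => 1
  simp only [mul_one, Finset.sum_const, nsmul_eq_mul, card_sphere_inter,
    hE.card_sphere_one] at h
  exact h

lemma sum_sq_dualEig_sphere_one (hE : Γ.IsPrimIdemSeq E θ) (hq : Γ.IsKrein E q)
    (hQ : Γ.IsQPolynomial q) (hts : Γ.IsDualEigs (E 1) ts) (x y : Γ.X) :
    ∑ t ∈ Γ.sphere x 1, ts (Γ.G.dist y t) ^ 2 =
      θ 2 * ts (Γ.G.dist x y) ^ 2 + (θ 0 - θ 2) * ts 0 +
        (θ 1 - θ 2) * q 1 1 1 * ts (Γ.G.dist x y) := by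
  have hn := Γ.n_ne_zero
  have h := sum_dualEig_mul_sphere_one hE hq hQ hts x y y
  rw [norton_apply_right hE hq hts] at h
  simp only [hts.apply, SimpleGraph.dist_self, Nat.cast_zero] at h
  have hl : ∑ t ∈ Γ.sphere x 1, ts (Γ.G.dist y t) ^ 2 =
      Γ.n * ∑ t ∈ Γ.sphere x 1, ts (Γ.G.dist y t) * ((Γ.n)⁻¹ * ts (Γ.G.dist y t)) := by
    rw [Finset.mul_sum]
    exact Finset.sum_congr rfl fun t _ => by field_simp
  rw [hl, h, Γ.G.dist_comm (u := y)]
  field_simp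

lemma sum_sphere_one_self (hE : Γ.IsPrimIdemSeq E θ) (g : ℤ → ℝ) (x : Γ.X) :
    ∑ t ∈ Γ.sphere x 1, g (Γ.G.dist x t) = θ 0 * g 1 := by
  rw [← hE.card_sphere_one x, ← nsmul_eq_mul, ← Finset.sum_const]
  refine Finset.sum_congr rfl fun t ht => ?_
  rw [show Γ.G.dist x t = 1 by simpa [sphere] using ht, Nat.cast_one]

lemma krein_one_one_one_eq (hE : Γ.IsPrimIdemSeq E θ) (hq : Γ.IsKrein E q)
    (hQ : Γ.IsQPolynomial q) (hts : Γ.IsDualEigs (E 1) ts) (hts' : Γ.DualDistinct ts) :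
    θ 0 * ts 1 = θ 1 * ts 0 ∧
      (θ 1 - θ 2) * q 1 1 1 = θ 1 * ts 1 - θ 2 * ts 0 - (θ 0 - θ 2) := by
  have hd := Γ.d_ge_two
  obtain ⟨x, y, hxy⟩ := Γ.dist_attained
  have h1 := sum_dualEig_sphere_one hE hts x x
  have h2 := sum_sq_dualEig_sphere_one hE hq hQ hts x x
  rw [sum_sphere_one_self hE ts] at h1
  rw [sum_sphere_one_self hE fun i => ts i ^ 2] at h2
  simp only [SimpleGraph.dist_self, Nat.cast_zero] at h1 h2
  refine ⟨h1, ?_⟩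
  have h0 : ts 0 ≠ 0 := by
    intro h0
    rw [h0, mul_zero] at h1
    rcases mul_eq_zero.1 h1 with h | h
    · have hcard := hE.card_sphere_one x
      rw [h, Nat.cast_eq_zero, Finset.card_eq_zero] at hcard
      have hne : x ≠ y := by
        rintro rfl
        rw [SimpleGraph.dist_self] at hxy
        omega
      have : Nontrivial Γ.X := ⟨x, y, hne⟩
      obtain ⟨t, ht⟩ := Γ.conn.preconnected.exists_adj_of_nontrivial x
      have : t ∈ Γ.sphere x 1 := by simpa [sphere, SimpleGraph.dist_eq_one_iff_adj] using ht
      simp [hcard] at this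
    · have := hts' 0 1 (by omega) (by omega) (by simpa [h0] using h.symm)
      omega
  apply mul_right_cancel₀ h0
  linear_combination ts 1 * h1 - h2

end DRG

/-- Theorem 4.5, second main result: the Norton product in
symmetric form. -/
theorem DRG.norton_product_symmetric_form (Γ : DRG) (E : ℕ → Matrix Γ.X Γ.X ℝ) (θ : ℕ → ℝ)
    (hE : Γ.IsPrimIdemSeq E θ)
    (q : ℕ → ℕ → ℕ → ℝ) (hq : Γ.IsKrein E q) (hQ : Γ.IsQPolynomial q)
    (ts : ℤ → ℝ) (hts : Γ.IsDualEigs (E 1) ts) (hts' : Γ.DualDistinct ts) (x y : Γ.X)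
    (hxy : x ≠ y) :
    Γ.norton (E 1) (E 1 *ᵥ Γ.hatv x) (E 1 *ᵥ Γ.hatv y) =
      (Γ.n * (θ 1 - θ 2))⁻¹ •
        ((ts ((Γ.G.dist x y : ℤ) - 1) - ts (Γ.G.dist x y)) •
            Γ.Cvec (E 1) ts x y +
          (ts ((Γ.G.dist x y : ℤ) + 1) - ts (Γ.G.dist x y)) •
            Γ.Bvec (E 1) ts x y +
          (θ 2 - θ 0) • (E 1 *ᵥ Γ.hatv x + E 1 *ᵥ Γ.hatv y)) := by
  have hd := Γ.d_ge_two
  have hn := Γ.n_ne_zero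
  have hθ : θ 1 - θ 2 ≠ 0 := fun h =>
    absurd (hE.2.2.2.2 1 2 (by omega) hd (sub_eq_zero.1 h)) (by norm_num)
  have hpos : 0 < Γ.G.dist x y := Γ.conn.pos_dist_of_ne hxy
  have h0i : ts 0 - ts (Γ.G.dist x y) ≠ 0 := fun h =>
    hpos.ne (hts' 0 _ (Nat.zero_le _) (Γ.dist_le x y) (by simpa using sub_eq_zero.1 h))
  obtain ⟨hk, hkrein⟩ := DRG.krein_one_one_one_eq hE hq hQ hts hts'
  have hlin := DRG.sum_dualEig_sphere_one hE hts x y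
  have hsq := DRG.sum_sq_dualEig_sphere_one hE hq hQ hts x y
  rw [DRG.sum_apply_dist_sphere_one hE hxy ts] at hlin
  rw [DRG.sum_apply_dist_sphere_one hE hxy fun i => ts i ^ 2] at hsq
  have hmulVec : ∀ S : Finset Γ.X, ∀ z, (E 1 *ᵥ ∑ t ∈ S, Γ.hatv t) z = ∑ t ∈ S, E 1 z t := by
    intro S z
    simp [Matrix.mulVec_sum, DRG.hatv]
  ext z
  have hsum := DRG.sum_dualEig_mul_sphere_one hE hq hQ hts x y z
  rw [DRG.sum_sphere_one_eq hxy] at hsum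
  have hAE : ∑ t ∈ Γ.sphere x 1, E 1 z t = θ 1 * E 1 z x := by
    simp only [hts.apply, ← Finset.mul_sum]
    rw [DRG.sum_dualEig_sphere_one hE hts, Γ.G.dist_comm (u := z)]
    ring
  rw [hAE, ← hmulVec, ← hmulVec] at hsum
  change _ * (E 1 *ᵥ Γ.minusv x y) z + _ * (E 1 *ᵥ Γ.plusv x y) z + _ = _ at hsum
  simp only [DRG.Cvec, DRG.Bvec, Pi.smul_apply, Pi.add_apply, Pi.sub_apply, smul_eq_mul]
  have hx : (E 1 *ᵥ Γ.hatv x) z = E 1 z x := by simp [DRG.hatv]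
  have hy : (E 1 *ᵥ Γ.hatv y) z = E 1 y z := by
    rw [hE.apply_comm (by omega) y z]
    simp [DRG.hatv]
  rw [hx, hy]
  rw [eq_inv_mul_iff_mul_eq₀ (mul_ne_zero hn hθ)]
  generalize Γ.norton (E 1) (E 1 *ᵥ Γ.hatv x) (E 1 *ᵥ Γ.hatv y) z = N at *
  generalize (E 1 *ᵥ Γ.minusv x y) z = M at *
  generalize (E 1 *ᵥ Γ.plusv x y) z = P at *
  generalize E 1 z x = e at *
  generalize E 1 y z = f at *
  generalize ts ((Γ.G.dist x y : ℤ) - 1) = u at *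
  generalize ts ((Γ.G.dist x y : ℤ) + 1) = v at *
  generalize ts (Γ.G.dist x y : ℤ) = w at *
  have hcoef : (u - w) * (Γ.c (Γ.G.dist x y) * ((ts 1 - u) / (ts 0 - w))) +
      (v - w) * (Γ.b (Γ.G.dist x y) * ((ts 1 - v) / (ts 0 - w))) =
      θ 2 - θ 0 - w * (θ 1 - θ 2) := by
    field_simp
    linear_combination (ts 1 + w) * hlin - hsq - w * hkrein - w * hk
  linear_combination e * hcoef - hsum
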